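/- arXiv:2507.09865 — 8 statements merged into one kernel-verified Lean document; each statement's English description precedes it below -/
import Mathlib

section
/- Let (X^s, p^s) ∈ ℝ^{N^s×N^s} × 𝒫_{N^s} for s = 1,…,S be finite networks, let λ ∈ Δ_{S−1}, let M ∈ ℕ, let q ∈ 𝒫_M, and for each s fix a coupling π^s ∈ Π(p^s, q). Define J_λ : ℝ^{M×M} → ℝ by J_λ(Y) := Σ_{s=1}^S λ_s Σ_{i,k∈[N^s]} Σ_{j,l∈[M]} (X^s_{ik} − Y_{jl})² π^s_{ij} π^s_{kl}. Then J_λ attains a minimum over ℝ^{M×M}. Moreover, if all entries of q are strictly positive, then J_λ has a unique minimizer Y* ∈ ℝ^{M×M}, given entrywise by Y*_{jl} = (1/(q_j q_l)) Σ_{s=1}^S λ_s ((π^s)ᵀ X^s π^s)_{jl} for all j, l ∈ [M]. -/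
open Finset Matrix

noncomputable section

/-- `p` is a probability vector on `Fin N`. -/
def IsProbVec {N : ℕ} (p : Fin N → ℝ) : Prop :=
  (∀ i, 0 ≤ p i) ∧ ∑ i, p i = 1

/-- The set of couplings `Π(p,q)` between probability vectors `p` and `q`. -/
def Couplings {N M : ℕ} (p : Fin N → ℝ) (q : Fin M → ℝ) :
    Set (Matrix (Fin N) (Fin M) ℝ) :=
  {π | (∀ i j, 0 ≤ π i j) ∧ (∀ i, ∑ j, π i j = p i) ∧ (∀ j, ∑ i, π i j = q j)}

theorem aux_expand {n M : ℕ} (X : Matrix (Fin n) (Fin n) ℝ) (q : Fin M → ℝ)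
    (π : Matrix (Fin n) (Fin M) ℝ) (h : ∀ j, ∑ i, π i j = q j)
    (Y : Matrix (Fin M) (Fin M) ℝ) :
    ∑ i, ∑ k, ∑ j, ∑ l, (X i k - Y j l) ^ 2 * π i j * π k l =
      (∑ i, ∑ k, ∑ j, ∑ l, X i k ^ 2 * π i j * π k l) +
      ∑ j, ∑ l, (q j * q l * Y j l ^ 2 - 2 * (πᵀ * X * π) j l * Y j l) := by
  have sw : ∀ f : Fin n → Fin n → Fin M → Fin M → ℝ,
      ∑ i, ∑ k, ∑ j, ∑ l, f i k j l = ∑ j, ∑ l, ∑ i, ∑ k, f i k j l := by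
    intro f
    calc _ = ∑ i, ∑ j, ∑ k, ∑ l, f i k j l :=
          Finset.sum_congr rfl fun i _ => Finset.sum_comm
      _ = ∑ j, ∑ i, ∑ l, ∑ k, f i k j l := by
          rw [Finset.sum_comm]
          exact Finset.sum_congr rfl fun j _ => Finset.sum_congr rfl fun i _ => Finset.sum_comm
      _ = _ := Finset.sum_congr rfl fun j _ => Finset.sum_comm
  rw [sw, sw, ← Finset.sum_add_distrib]
  refine Finset.sum_congr rfl fun j _ => ?_
  rw [← Finset.sum_add_distrib]
  refine Finset.sum_congr rfl fun l _ => ?_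
  have h1 : q j * q l * Y j l ^ 2 = ∑ i, ∑ k, Y j l ^ 2 * π i j * π k l := by
    rw [← h j, ← h l, Finset.sum_mul_sum, Finset.sum_mul]
    refine Finset.sum_congr rfl fun i _ => ?_
    rw [Finset.sum_mul]
    exact Finset.sum_congr rfl fun k _ => by ring
  have h2 : 2 * (πᵀ * X * π) j l * Y j l = ∑ i, ∑ k, 2 * X i k * Y j l * π i j * π k l := by
    rw [Finset.sum_comm, Matrix.mul_apply, Finset.mul_sum, Finset.sum_mul]
    refine Finset.sum_congr rfl fun k _ => ?_
    rw [Matrix.mul_apply, Finset.sum_mul, Finset.mul_sum, Finset.sum_mul]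
    refine Finset.sum_congr rfl fun i _ => ?_
    rw [Matrix.transpose_apply]; ring
  rw [h1, h2, ← Finset.sum_sub_distrib, ← Finset.sum_add_distrib]
  refine Finset.sum_congr rfl fun i _ => ?_
  rw [← Finset.sum_sub_distrib, ← Finset.sum_add_distrib]
  exact Finset.sum_congr rfl fun k _ => by ring

theorem aux_zero {n M : ℕ} (X : Matrix (Fin n) (Fin n) ℝ) (q : Fin M → ℝ)
    (π : Matrix (Fin n) (Fin M) ℝ) (h0 : ∀ i j, 0 ≤ π i j) (h : ∀ j, ∑ i, π i j = q j)
    (j l : Fin M) (hz : q j * q l = 0) : (πᵀ * X * π) j l = 0 := by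
  have key : ∀ j, q j = 0 → ∀ i, π i j = 0 := by
    intro j hj i
    rw [← h j, Finset.sum_eq_zero_iff_of_nonneg fun i _ => h0 i j] at hj
    exact hj i (Finset.mem_univ _)
  rcases mul_eq_zero.1 hz with hz | hz
  · simp [Matrix.mul_apply, key j hz]
  · simp [Matrix.mul_apply, key l hz]

/-- With fixed couplings `π^s ∈ Π(p^s,q)` and weights `λ ∈ Δ_{S-1}`, the
functional `J_λ(Y) = Σ_s λ_s Σ_{i,k,j,l} (X^s_{ik} − Y_{jl})² π^s_{ij} π^s_{kl}` attains a
minimum over `ℝ^{M×M}`; if all entries of `q` are strictly positive, the minimizer is unique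
and given entrywise by `Y*_{jl} = (1/(q_j q_l)) Σ_s λ_s ((π^s)ᵀ X^s π^s)_{jl}`. -/
theorem fixed_couplings_functional_has_unique_minimizer {S M : ℕ} (N : Fin S → ℕ)
    (X : ∀ s, Matrix (Fin (N s)) (Fin (N s)) ℝ)
    (p : ∀ s, Fin (N s) → ℝ) (hp : ∀ s, IsProbVec (p s))
    (lam : Fin S → ℝ) (hlam : IsProbVec lam)
    (q : Fin M → ℝ) (hq : IsProbVec q)
    (π : ∀ s, Matrix (Fin (N s)) (Fin M) ℝ)
    (hπ : ∀ s, π s ∈ Couplings (p s) q)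
    (J : Matrix (Fin M) (Fin M) ℝ → ℝ)
    (hJ : ∀ Y, J Y = ∑ s, lam s *
        ∑ i, ∑ k, ∑ j, ∑ l, (X s i k - Y j l) ^ 2 * π s i j * π s k l) :
    (∃ Ymin : Matrix (Fin M) (Fin M) ℝ, ∀ Y, J Ymin ≤ J Y) ∧
    ((∀ j, 0 < q j) →
      (∃! Ystar : Matrix (Fin M) (Fin M) ℝ, ∀ Y, J Ystar ≤ J Y) ∧
      (∀ Ystar : Matrix (Fin M) (Fin M) ℝ, (∀ Y, J Ystar ≤ J Y) →
        ∀ j l, Ystar j l = (1 / (q j * q l)) *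
          ∑ s, lam s * ((π s)ᵀ * X s * π s) j l)) := by
  set B : Matrix (Fin M) (Fin M) ℝ := fun j l => ∑ s, lam s * ((π s)ᵀ * X s * π s) j l with hB
  set Z : Matrix (Fin M) (Fin M) ℝ := fun j l => (1 / (q j * q l)) * B j l with hZ
  have hBZ : ∀ j l, B j l = q j * q l * Z j l := by
    intro j l
    by_cases hz : q j * q l = 0
    · rw [hz, zero_mul, hB]
      exact Finset.sum_eq_zero fun s _ => by
        rw [aux_zero (X s) q (π s) (hπ s).1 (hπ s).2.2 j l hz, mul_zero]
    · simp only [hZ]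
      rw [← mul_assoc, mul_one_div_cancel hz, one_mul]
  obtain ⟨C, hC⟩ : ∃ C : ℝ, ∀ Y, J Y = C +
      ∑ j, ∑ l, (q j * q l * Y j l ^ 2 - 2 * B j l * Y j l) := by
    refine ⟨∑ s, lam s * ∑ i, ∑ k, ∑ j, ∑ l, X s i k ^ 2 * π s i j * π s k l, fun Y => ?_⟩
    rw [hJ]
    simp_rw [fun s => aux_expand (X s) q (π s) (hπ s).2.2 Y, mul_add, Finset.sum_add_distrib]
    congr 1
    simp_rw [Finset.mul_sum]
    rw [Finset.sum_comm]
    refine Finset.sum_congr rfl fun j _ => ?_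
    rw [Finset.sum_comm]
    refine Finset.sum_congr rfl fun l _ => ?_
    simp_rw [mul_sub, Finset.sum_sub_distrib]
    rw [← Finset.sum_mul, hlam.2, one_mul, hB]
    simp only [Finset.mul_sum, Finset.sum_mul]
    congr 1
    exact Finset.sum_congr rfl fun s _ => by ring
  have hD : ∀ Y, J Y = J Z + ∑ j, ∑ l, q j * q l * (Y j l - Z j l) ^ 2 := by
    intro Y
    rw [hC, hC, add_assoc, ← Finset.sum_add_distrib]
    congr 1
    refine Finset.sum_congr rfl fun j _ => ?_
    rw [← Finset.sum_add_distrib]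
    refine Finset.sum_congr rfl fun l _ => ?_
    rw [hBZ]; ring
  have hnn : ∀ (Y : Matrix (Fin M) (Fin M) ℝ) j l, 0 ≤ q j * q l * (Y j l - Z j l) ^ 2 :=
    fun Y j l => mul_nonneg (mul_nonneg (hq.1 j) (hq.1 l)) (sq_nonneg _)
  have hmin : ∀ Y, J Z ≤ J Y := by
    intro Y
    rw [hD Y]
    have := Finset.sum_nonneg fun j (_ : j ∈ Finset.univ) =>
      Finset.sum_nonneg fun l (_ : l ∈ Finset.univ) => hnn Y j l
    linarith
  refine ⟨⟨Z, hmin⟩, fun hpos => ?_⟩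
  have huniq : ∀ W : Matrix (Fin M) (Fin M) ℝ, (∀ Y, J W ≤ J Y) → ∀ j l, W j l = Z j l := by
    intro W hW j l
    have h1 := hW Z
    rw [hD W] at h1
    have hs : ∀ j ∈ Finset.univ, 0 ≤ ∑ l, q j * q l * (W j l - Z j l) ^ 2 :=
      fun j _ => Finset.sum_nonneg fun l _ => hnn W j l
    have h2 : ∑ j, ∑ l, q j * q l * (W j l - Z j l) ^ 2 = 0 :=
      le_antisymm (by linarith) (Finset.sum_nonneg hs)
    have h3 := (Finset.sum_eq_zero_iff_of_nonneg hs).1 h2 j (Finset.mem_univ _)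
    have h4 := (Finset.sum_eq_zero_iff_of_nonneg fun l _ => hnn W j l).1 h3 l (Finset.mem_univ _)
    have h5 := (mul_eq_zero.1 h4).resolve_left (mul_pos (hpos j) (hpos l)).ne'
    exact sub_eq_zero.1 (pow_eq_zero_iff two_ne_zero |>.1 h5)
  exact ⟨⟨Z, hmin, fun W hW => Matrix.ext (huniq W hW)⟩, huniq⟩
end
end

section
/- Let (X^s, p^s) ∈ ℝ^{N^s×N^s} × 𝒫_{N^s} for s = 1,…,S be finite networks, let M ∈ ℕ, and let q ∈ 𝒫_M have all entries strictly positive. Let λ ∈ Δ_{S−1} and suppose Y_λ ∈ ℝ^{M×M} is a GW barycenter for weights λ, i.e., Y_λ minimizes Y ↦ Σ_{s=1}^S λ_s GW²((X^s,p^s),(Y,q)) over ℝ^{M×M}. For each s, let π^{*s} ∈ Π(p^s, q) be an optimal coupling for GW((X^s,p^s),(Y_λ,q)). Then Y_λ = (1/(qqᵀ)) ⊙ Σ_{s=1}^S λ_s (π^{*s})ᵀ X^s π^{*s}, i.e., (Y_λ)_{jl} = (1/(q_j q_l)) Σ_{s=1}^S λ_s ((π^{*s})ᵀ X^s π^{*s})_{jl}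 for all j, l ∈ [M]. -/
open Finset Matrix

noncomputable section

/-- The Gromov–Wasserstein objective for a coupling `π`. -/
def GWobj {N M : ℕ} (X : Matrix (Fin N) (Fin N) ℝ) (Y : Matrix (Fin M) (Fin M) ℝ)
    (π : Matrix (Fin N) (Fin M) ℝ) : ℝ :=
  ∑ i, ∑ k, ∑ j, ∑ l, (X i k - Y j l) ^ 2 * π i j * π k l

/-- The squared Gromov–Wasserstein discrepancy `GW²((X,p),(Y,q))`. -/
def GW2 {N M : ℕ} (X : Matrix (Fin N) (Fin N) ℝ) (p : Fin N → ℝ)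
    (Y : Matrix (Fin M) (Fin M) ℝ) (q : Fin M → ℝ) : ℝ :=
  sInf (GWobj X Y '' Couplings p q)

/-- `π` is an optimal coupling for `GW((X,p),(Y,q))`: it is a coupling attaining
the minimum defining `GW²`. -/
def IsOptimalCoupling {N M : ℕ} (X : Matrix (Fin N) (Fin N) ℝ) (p : Fin N → ℝ)
    (Y : Matrix (Fin M) (Fin M) ℝ) (q : Fin M → ℝ)
    (π : Matrix (Fin N) (Fin M) ℝ) : Prop :=
  π ∈ Couplings p q ∧ GWobj X Y π = GW2 X p Y q

theorem GWobj_perturb {N M : ℕ} (X : Matrix (Fin N) (Fin N) ℝ) (Y : Matrix (Fin M) (Fin M) ℝ)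
    (π : Matrix (Fin N) (Fin M) ℝ) (q : Fin M → ℝ) (hπ : ∀ j, ∑ i, π i j = q j)
    (j l : Fin M) (t : ℝ) :
    GWobj X (fun a b => Y a b + if a = j then (if b = l then t else 0) else 0) π
      = GWobj X Y π - 2 * t * ((πᵀ * X * π) j l - Y j l * (q j * q l))
        + t ^ 2 * (q j * q l) := by
  have h1 : ∀ i k, (∑ a, ∑ b, (X i k - (Y a b + if a = j then (if b = l then t else 0) else 0)) ^ 2
        * π i a * π k b)
      = (∑ a, ∑ b, (X i k - Y a b) ^ 2 * π i a * π k b)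
        + (- 2 * t * (π i j * X i k * π k l) + (2 * t * Y j l + t ^ 2) * (π i j * π k l)) := by
    intro i k
    have h2 : ∀ a b, (X i k - (Y a b + if a = j then (if b = l then t else 0) else 0)) ^ 2
        * π i a * π k b = (X i k - Y a b) ^ 2 * π i a * π k b
        + if a = j then (if b = l then (- 2 * t * (π i j * X i k * π k l)
          + (2 * t * Y j l + t ^ 2) * (π i j * π k l)) else 0) else 0 := by
      intro a b
      split_ifs with ha hb
      · subst ha; subst hb; ring
      · ring
      · ring
    simp only [h2, Finset.sum_add_distrib]
    congr 1
    simp [Finset.sum_ite_irrel]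
  have hA : (πᵀ * X * π) j l = ∑ i, ∑ k, π i j * X i k * π k l := by
    simp only [Matrix.mul_apply, Matrix.transpose_apply, Finset.sum_mul]
    rw [Finset.sum_comm]
  have hB : q j * q l = ∑ i, ∑ k, π i j * π k l := by
    rw [← hπ j, ← hπ l, Finset.sum_mul_sum]
  rw [hA, hB]
  unfold GWobj
  simp only [h1, Finset.sum_add_distrib, ← Finset.mul_sum]
  ring

theorem GW2_le_obj {N M : ℕ} (X : Matrix (Fin N) (Fin N) ℝ) (p : Fin N → ℝ)
    (Y : Matrix (Fin M) (Fin M) ℝ) (q : Fin M → ℝ) (π : Matrix (Fin N) (Fin M) ℝ)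
    (hπ : π ∈ Couplings p q) : GW2 X p Y q ≤ GWobj X Y π := by
  refine csInf_le ⟨0, ?_⟩ ⟨π, hπ, rfl⟩
  rintro _ ⟨ρ, hρ, rfl⟩
  exact Finset.sum_nonneg fun i _ => Finset.sum_nonneg fun k _ => Finset.sum_nonneg fun j _ =>
    Finset.sum_nonneg fun l _ =>
      mul_nonneg (mul_nonneg (sq_nonneg _) (hρ.1 i j)) (hρ.1 k l)

/-- If `Y_λ` is a GW barycenter of the templates `(X^s,p^s)` for weights
`λ ∈ Δ_{S-1}` (with fixed size `M` and strictly positive node weights `q`), and `π^{*s}` is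
an optimal coupling for `GW((X^s,p^s),(Y_λ,q))` for each `s`, then
`(Y_λ)_{jl} = (1/(q_j q_l)) Σ_s λ_s ((π^{*s})ᵀ X^s π^{*s})_{jl}` for all `j,l`. -/
theorem barycenter_fixed_point_formula {S M : ℕ} (N : Fin S → ℕ)
    (X : ∀ s, Matrix (Fin (N s)) (Fin (N s)) ℝ)
    (p : ∀ s, Fin (N s) → ℝ) (hp : ∀ s, IsProbVec (p s))
    (q : Fin M → ℝ) (hq : IsProbVec q) (hqpos : ∀ j, 0 < q j)
    (lam : Fin S → ℝ) (hlam : IsProbVec lam)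
    (Ylam : Matrix (Fin M) (Fin M) ℝ)
    (hbary : ∀ Y : Matrix (Fin M) (Fin M) ℝ,
        ∑ s, lam s * GW2 (X s) (p s) Ylam q ≤ ∑ s, lam s * GW2 (X s) (p s) Y q)
    (πs : ∀ s, Matrix (Fin (N s)) (Fin M) ℝ)
    (hopt : ∀ s, IsOptimalCoupling (X s) (p s) Ylam q (πs s)) :
    ∀ j l, Ylam j l = (1 / (q j * q l)) *
        ∑ s, lam s * ((πs s)ᵀ * X s * πs s) j l := by
  intro j l
  have hc : 0 < q j * q l := mul_pos (hqpos j) (hqpos l)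
  set B := ∑ s, lam s * ((πs s)ᵀ * X s * πs s) j l with hB
  have key : ∀ t : ℝ, 0 ≤ - 2 * t * (B - Ylam j l * (q j * q l)) + t ^ 2 * (q j * q l) := by
    intro t
    have h1 := hbary (fun a b => Ylam a b + if a = j then (if b = l then t else 0) else 0)
    have h2 := h1.trans (Finset.sum_le_sum fun s _ => mul_le_mul_of_nonneg_left
      (GW2_le_obj (X s) (p s) _ q (πs s) (hopt s).1) (hlam.1 s))
    have h3 : ∀ s, lam s * GWobj (X s)
        (fun a b => Ylam a b + if a = j then (if b = l then t else 0) else 0) (πs s)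
        = lam s * GW2 (X s) (p s) Ylam q + (- 2 * t) * (lam s * ((πs s)ᵀ * X s * πs s) j l)
          + lam s * (2 * t * (Ylam j l * (q j * q l)) + t ^ 2 * (q j * q l)) := by
      intro s
      rw [GWobj_perturb (X s) Ylam (πs s) q (hopt s).1.2.2 j l t, (hopt s).2]
      ring
    simp only [h3, Finset.sum_add_distrib, ← Finset.mul_sum, ← Finset.sum_mul, hlam.2] at h2
    rw [← hB] at h2
    linarith
  have h4 := key ((B - Ylam j l * (q j * q l)) / (q j * q l))
  have h5 : - 2 * ((B - Ylam j l * (q j * q l)) / (q j * q l)) * (B - Ylam j l * (q j * q l))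
      + ((B - Ylam j l * (q j * q l)) / (q j * q l)) ^ 2 * (q j * q l)
      = - ((B - Ylam j l * (q j * q l)) ^ 2 / (q j * q l)) := by
    generalize B - Ylam j l * (q j * q l) = D
    generalize q j * q l = c at hc
    field_simp
    ring
  rw [h5] at h4
  have h6 : (B - Ylam j l * (q j * q l)) ^ 2 ≤ 0 := by
    by_contra hcon
    have := div_pos (not_le.mp hcon) hc
    linarith
  have h7 : B - Ylam j l * (q j * q l) = 0 := by
    exact pow_eq_zero_iff (two_ne_zero) |>.mp (le_antisymm h6 (sq_nonneg _))
  have h8 : B = Ylam j l * (q j * q l) := by linarith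
  rw [h8, one_div, mul_comm, mul_assoc, mul_inv_cancel₀ hc.ne', mul_one]
end
end

section
/- Let (X^s, p^s) ∈ ℝ^{N^s×N^s} × 𝒫_{N^s} for s = 1,…,S be finite networks, let M ∈ ℕ, let q ∈ 𝒫_M have all entries strictly positive, and let λ ∈ Δ_{S−1}. For each Y ∈ ℝ^{M×M} and each s ∈ [S], let π(Y,s) ∈ Π(p^s, q) be an (arbitrarily chosen) optimal coupling for GW((X^s,p^s),(Y,q)), and define ρ_λ(Y) := (1/(qqᵀ)) ⊙ Σ_{s=1}^S λ_s (π(Y,s))ᵀ X^s π(Y,s). Then every Y_λ ∈ ℝ^{M×M} that minimizes Y ↦ Σ_{s=1}^S λ_s GW²((X^s,p^s),(Y,q)) over ℝ^{M×M} is a fixed point of ρ_λ, i.e., ρ_λ(Y_λ) = Y_λ, regardless of the choice of optimal couplings. -/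
open Finset Matrix

noncomputable section

lemma GWobj_expand {N M : ℕ} (X : Matrix (Fin N) (Fin N) ℝ) (p : Fin N → ℝ) (q : Fin M → ℝ)
    (π : Matrix (Fin N) (Fin M) ℝ) (h : π ∈ Couplings p q) (Y : Matrix (Fin M) (Fin M) ℝ) :
    GWobj X Y π = (∑ i, ∑ k, (X i k) ^ 2 * p i * p k) +
      ∑ j, ∑ l, (q j * q l * (Y j l) ^ 2 - 2 * Y j l * (πᵀ * X * π) j l) := by
  obtain ⟨_, h1, h2⟩ := h
  have e1 : (∑ i, ∑ k, (X i k) ^ 2 * p i * p k)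
      = ∑ i, ∑ k, ∑ j, ∑ l, (X i k) ^ 2 * π i j * π k l := by
    refine sum_congr rfl fun i _ => sum_congr rfl fun k _ => ?_
    rw [← h1 i, ← h1 k]
    simp only [mul_sum, sum_mul]
    rw [sum_comm]
  have e2 : (∑ j, ∑ l, (q j * q l * (Y j l) ^ 2 - 2 * Y j l * (πᵀ * X * π) j l))
      = ∑ j, ∑ l, ∑ i, ∑ k, ((Y j l) ^ 2 - 2 * X i k * Y j l) * π i j * π k l := by
    refine sum_congr rfl fun j _ => sum_congr rfl fun l _ => ?_
    rw [← h2 j, ← h2 l]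
    simp only [Matrix.mul_apply, Matrix.transpose_apply, mul_sum, sum_mul]
    rw [sum_comm (f := fun x i => 2 * Y j l * (π i j * X i x * π x l)), sum_comm]
    simp only [← sum_sub_distrib]
    refine sum_congr rfl fun i _ => sum_congr rfl fun k _ => ?_
    ring
  have e3 : ∀ f : Fin M → Fin M → Fin N → Fin N → ℝ,
      ∑ j, ∑ l, ∑ i, ∑ k, f j l i k = ∑ i, ∑ k, ∑ j, ∑ l, f j l i k := by
    intro f
    calc _ = ∑ j, ∑ i, ∑ l, ∑ k, f j l i k := sum_congr rfl fun j _ => sum_comm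
      _ = ∑ i, ∑ j, ∑ l, ∑ k, f j l i k := sum_comm
      _ = ∑ i, ∑ j, ∑ k, ∑ l, f j l i k :=
        sum_congr rfl fun i _ => sum_congr rfl fun j _ => sum_comm
      _ = _ := sum_congr rfl fun i _ => sum_comm
  rw [e1, e2, e3, GWobj]
  simp only [← sum_add_distrib]
  refine sum_congr rfl fun i _ => sum_congr rfl fun k _ =>
    sum_congr rfl fun j _ => sum_congr rfl fun l _ => ?_
  ring

lemma GW2_le {N M : ℕ} (X : Matrix (Fin N) (Fin N) ℝ) (p : Fin N → ℝ) (q : Fin M → ℝ)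
    (π : Matrix (Fin N) (Fin M) ℝ) (h : π ∈ Couplings p q) (Y : Matrix (Fin M) (Fin M) ℝ) :
    GW2 X p Y q ≤ GWobj X Y π := by
  refine csInf_le ⟨0, ?_⟩ ⟨π, h, rfl⟩
  rintro _ ⟨σ, hσ, rfl⟩
  refine sum_nonneg fun i _ => sum_nonneg fun k _ => sum_nonneg fun j _ => sum_nonneg fun l _ => ?_
  have := hσ.1 i j
  have := hσ.1 k l
  positivity

/-- Given, for every `Y ∈ ℝ^{M×M}` and every `s`, an (arbitrarily chosen)
optimal coupling `π(Y,s)` for `GW((X^s,p^s),(Y,q))`, define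
`ρ_λ(Y) := (1/(qqᵀ)) ⊙ Σ_s λ_s (π(Y,s))ᵀ X^s π(Y,s)`. Then every minimizer `Y_λ` of
`Y ↦ Σ_s λ_s GW²((X^s,p^s),(Y,q))` is a fixed point of `ρ_λ`, regardless of the choice
of optimal couplings. -/
theorem barycenter_is_fixed_point {S M : ℕ} (N : Fin S → ℕ)
    (X : ∀ s, Matrix (Fin (N s)) (Fin (N s)) ℝ)
    (p : ∀ s, Fin (N s) → ℝ) (hp : ∀ s, IsProbVec (p s))
    (q : Fin M → ℝ) (hq : IsProbVec q) (hqpos : ∀ j, 0 < q j)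
    (lam : Fin S → ℝ) (hlam : IsProbVec lam)
    (π : Matrix (Fin M) (Fin M) ℝ → ∀ s : Fin S, Matrix (Fin (N s)) (Fin M) ℝ)
    (hπ : ∀ (Y : Matrix (Fin M) (Fin M) ℝ) (s : Fin S),
        IsOptimalCoupling (X s) (p s) Y q (π Y s))
    (ρ : Matrix (Fin M) (Fin M) ℝ → Matrix (Fin M) (Fin M) ℝ)
    (hρ : ∀ Y j l, ρ Y j l = (1 / (q j * q l)) *
        ∑ s, lam s * ((π Y s)ᵀ * X s * π Y s) j l)
    (Ylam : Matrix (Fin M) (Fin M) ℝ)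
    (hbary : ∀ Y : Matrix (Fin M) (Fin M) ℝ,
        ∑ s, lam s * GW2 (X s) (p s) Ylam q ≤ ∑ s, lam s * GW2 (X s) (p s) Y q) :
    ρ Ylam = Ylam := by
  have key : ∑ s, lam s * GWobj (X s) Ylam (π Ylam s)
      ≤ ∑ s, lam s * GWobj (X s) (ρ Ylam) (π Ylam s) := by
    calc _ = ∑ s, lam s * GW2 (X s) (p s) Ylam q :=
          sum_congr rfl fun s _ => by rw [(hπ Ylam s).2]
      _ ≤ _ := hbary (ρ Ylam)
      _ ≤ _ := sum_le_sum fun s _ =>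
          mul_le_mul_of_nonneg_left (GW2_le _ _ _ _ (hπ Ylam s).1 _) (hlam.1 s)
  have exp : ∀ Z : Matrix (Fin M) (Fin M) ℝ, ∑ s, lam s * GWobj (X s) Z (π Ylam s)
      = (∑ s, lam s * ∑ i, ∑ k, (X s i k) ^ 2 * p s i * p s k) +
        ∑ j, ∑ l, (q j * q l * ((Z j l) ^ 2 - 2 * Z j l * ρ Ylam j l)) := by
    intro Z
    have : ∀ s, lam s * GWobj (X s) Z (π Ylam s)
      = lam s * (∑ i, ∑ k, (X s i k) ^ 2 * p s i * p s k) +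
        ∑ j, ∑ l, lam s * (q j * q l * (Z j l) ^ 2
          - 2 * Z j l * ((π Ylam s)ᵀ * X s * π Ylam s) j l) := by
      intro s
      rw [GWobj_expand _ _ _ _ (hπ Ylam s).1, mul_add]
      simp only [mul_sum]
    simp only [this, sum_add_distrib]
    congr 1
    rw [sum_comm]
    refine sum_congr rfl fun j _ => ?_
    rw [sum_comm]
    refine sum_congr rfl fun l _ => ?_
    have hR : q j * q l * ρ Ylam j l
        = ∑ s, lam s * ((π Ylam s)ᵀ * X s * π Ylam s) j l := by
      rw [hρ]
      have := (hqpos j).ne'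
      have := (hqpos l).ne'
      field_simp
    calc _ = (∑ s, lam s) * (q j * q l * (Z j l) ^ 2)
          - 2 * Z j l * ∑ s, lam s * ((π Ylam s)ᵀ * X s * π Ylam s) j l := by
            rw [sum_mul, mul_sum, ← sum_sub_distrib]
            exact sum_congr rfl fun s _ => by ring
      _ = _ := by
            rw [← hR, hlam.2]
            ring
  rw [exp, exp] at key
  have nn : ∀ j l, 0 ≤ q j * q l * (Ylam j l - ρ Ylam j l) ^ 2 := fun j l =>
    mul_nonneg (mul_pos (hqpos j) (hqpos l)).le (sq_nonneg _)
  have le0 : ∑ j, ∑ l, q j * q l * (Ylam j l - ρ Ylam j l) ^ 2 ≤ 0 := by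
    have : ∑ j, ∑ l, q j * q l * (Ylam j l - ρ Ylam j l) ^ 2
        = ∑ j, ∑ l, (q j * q l * ((Ylam j l) ^ 2 - 2 * Ylam j l * ρ Ylam j l))
        - ∑ j, ∑ l, (q j * q l * ((ρ Ylam j l) ^ 2 - 2 * ρ Ylam j l * ρ Ylam j l)) := by
      simp only [← sum_sub_distrib]
      exact sum_congr rfl fun j _ => sum_congr rfl fun l _ => by ring
    linarith
  have eq0 := le_antisymm le0 (sum_nonneg fun j _ => sum_nonneg fun l _ => nn j l)
  ext j l
  have h1 := (sum_eq_zero_iff_of_nonneg fun j _ => sum_nonneg fun l _ => nn j l).1 eq0 j (mem_univ j)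
  have h2 := (sum_eq_zero_iff_of_nonneg fun l _ => nn j l).1 h1 l (mem_univ l)
  have h3 := (mul_eq_zero.1 h2).resolve_left (mul_pos (hqpos j) (hqpos l)).ne'
  have h4 := pow_eq_zero_iff (two_ne_zero) |>.1 h3
  linarith
end
end

section
/- Let (X^s, p^s) ∈ ℝ^{N^s×N^s} × 𝒫_{N^s} for s = 1,…,S be finite networks, let M ∈ ℕ, let q ∈ 𝒫_M have all entries strictly positive, and let Y ∈ ℝ^{M×M}. For each s ∈ [S] let π^s ∈ Π(p^s, q) be an optimal coupling for GW((X^s,p^s),(Y,q)) and set F(Y,s) := (1/(qqᵀ)) ⊙ (π^s)ᵀ X^s π^s. Define the S×S matrix Q by Q_{sr} := tr((F(Y,s) − Y)ᵀ (F(Y,r) − Y)). Then: (i) Q is symmetric positive semidefinite; (ii) for every λ ∈ Δ_{S−1}, λᵀQλ = 0 if and only if Y = Σ_{s=1}^S λ_s F(Y,s); (iii) if Y is a GW barycenter of the templates, i.e., Y minimizes Z ↦ Σ_{s=1}^S (λ_Y)_s GW²((X^s,p^s),(Z,q)) over Z ∈ ℝ^{M×M} for some λ_Y ∈ Δ_{S−1},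 then min_{λ∈Δ_{S−1}} λᵀQλ = 0 and this minimum is attained at λ_Y. -/
open Finset Matrix

noncomputable section

lemma aux_quad {S M : ℕ} (G : Fin S → Matrix (Fin M) (Fin M) ℝ) (a : Fin S → ℝ) :
    ∑ s, ∑ r, a s * Matrix.trace ((G s)ᵀ * G r) * a r
      = ∑ j, ∑ l, (∑ s, a s * G s j l) ^ 2 := by
  have h1 : ∀ s r, a s * Matrix.trace ((G s)ᵀ * G r) * a r
      = ∑ j, ∑ l, (a s * G s j l) * (a r * G r j l) := by
    intro s r
    rw [Finset.sum_comm]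
    simp only [Matrix.trace, Matrix.diag, Matrix.mul_apply, Matrix.transpose_apply,
      Finset.mul_sum, Finset.sum_mul]
    refine Finset.sum_congr rfl fun j _ => Finset.sum_congr rfl fun l _ => ?_
    ring
  simp only [h1, sq, Finset.sum_mul_sum]
  calc _ = ∑ s, ∑ j, ∑ r, ∑ l, (a s * G s j l) * (a r * G r j l) :=
        Finset.sum_congr rfl fun s _ => Finset.sum_comm
    _ = ∑ j, ∑ s, ∑ r, ∑ l, (a s * G s j l) * (a r * G r j l) := Finset.sum_comm
    _ = _ := by
        refine Finset.sum_congr rfl fun j _ => ?_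
        rw [Finset.sum_comm' (t' := univ) (s' := fun _ => univ) (by simp)]
        rw [Finset.sum_comm]
        calc _ = ∑ s, ∑ l, ∑ r, (a s * G s j l) * (a r * G r j l) :=
              Finset.sum_congr rfl fun s _ => Finset.sum_comm
          _ = _ := Finset.sum_comm

lemma aux_obj {N M : ℕ} (X : Matrix (Fin N) (Fin N) ℝ) (Z : Matrix (Fin M) (Fin M) ℝ)
    (q : Fin M → ℝ) (hqpos : ∀ j, 0 < q j)
    (π : Matrix (Fin N) (Fin M) ℝ) (hπ : ∀ j, ∑ i, π i j = q j)
    (F : Matrix (Fin M) (Fin M) ℝ)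
    (hF : ∀ j l, F j l = (1 / (q j * q l)) * (πᵀ * X * π) j l) :
    GWobj X Z π = (∑ j, ∑ l, ∑ i, ∑ k, X i k ^ 2 * π i j * π k l)
      + ∑ j, ∑ l, q j * q l * (Z j l ^ 2 - 2 * Z j l * F j l) := by
  have h1 : GWobj X Z π = ∑ j, ∑ l, ∑ i, ∑ k, (X i k - Z j l) ^ 2 * π i j * π k l := by
    unfold GWobj
    calc _ = ∑ i, ∑ j, ∑ k, ∑ l, (X i k - Z j l) ^ 2 * π i j * π k l :=
          Finset.sum_congr rfl fun i _ => Finset.sum_comm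
      _ = ∑ j, ∑ i, ∑ k, ∑ l, (X i k - Z j l) ^ 2 * π i j * π k l := Finset.sum_comm
      _ = ∑ j, ∑ i, ∑ l, ∑ k, (X i k - Z j l) ^ 2 * π i j * π k l :=
          Finset.sum_congr rfl fun j _ => Finset.sum_congr rfl fun i _ => Finset.sum_comm
      _ = _ := Finset.sum_congr rfl fun j _ => Finset.sum_comm
  rw [h1, ← Finset.sum_add_distrib]
  refine Finset.sum_congr rfl fun j _ => ?_
  rw [← Finset.sum_add_distrib]
  refine Finset.sum_congr rfl fun l _ => ?_
  have hj := (hqpos j).ne'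
  have hl := (hqpos l).ne'
  have h2 : q j * q l * F j l = ∑ i, ∑ k, X i k * π i j * π k l := by
    rw [hF]
    have : q j * q l * (1 / (q j * q l) * (πᵀ * X * π) j l) = (πᵀ * X * π) j l := by
      field_simp
    rw [this, Matrix.mul_apply, Finset.sum_comm]
    refine Finset.sum_congr rfl fun k _ => ?_
    rw [Matrix.mul_apply, Finset.sum_mul]
    refine Finset.sum_congr rfl fun i _ => ?_
    rw [Matrix.transpose_apply]; ring
  have h3 : q j * q l = ∑ i, ∑ k, π i j * π k l := by
    rw [← hπ j, ← hπ l, Finset.sum_mul_sum]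
  have h4 : q j * q l * (Z j l ^ 2 - 2 * Z j l * F j l)
      = Z j l ^ 2 * (q j * q l) - 2 * Z j l * (q j * q l * F j l) := by ring
  rw [h4, h2, h3]
  simp only [Finset.mul_sum, ← Finset.sum_sub_distrib, ← Finset.sum_add_distrib]
  refine Finset.sum_congr rfl fun i _ => Finset.sum_congr rfl fun k _ => ?_
  ring

lemma aux_gw_le {N M : ℕ} (X : Matrix (Fin N) (Fin N) ℝ) (p : Fin N → ℝ)
    (Z : Matrix (Fin M) (Fin M) ℝ) (q : Fin M → ℝ)
    (π : Matrix (Fin N) (Fin M) ℝ) (hπ : π ∈ Couplings p q) :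
    GW2 X p Z q ≤ GWobj X Z π := by
  refine csInf_le ⟨0, ?_⟩ ⟨π, hπ, rfl⟩
  rintro _ ⟨ρ, hρ, rfl⟩
  refine Finset.sum_nonneg fun i _ => Finset.sum_nonneg fun k _ => Finset.sum_nonneg fun j _ =>
    Finset.sum_nonneg fun l _ => ?_
  exact mul_nonneg (mul_nonneg (sq_nonneg _) (hρ.1 _ _)) (hρ.1 _ _)

/-- With `F(Y,s) := (1/(qqᵀ)) ⊙ (π^s)ᵀ X^s π^s` for optimal couplings `π^s`
of `GW((X^s,p^s),(Y,q))`, and `Q_{sr} := tr((F(Y,s) − Y)ᵀ(F(Y,r) − Y))`: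
(i) `Q` is symmetric positive semidefinite;
(ii) for every `λ ∈ Δ_{S-1}`, `λᵀQλ = 0` iff `Y = Σ_s λ_s F(Y,s)`;
(iii) if `Y` is a GW barycenter for some `λ_Y ∈ Δ_{S-1}`, then `λ_YᵀQλ_Y = 0` and `λ_Y`
minimizes `λ ↦ λᵀQλ` over `Δ_{S-1}`. -/
theorem analysis_quadratic_program {S M : ℕ} (N : Fin S → ℕ)
    (X : ∀ s, Matrix (Fin (N s)) (Fin (N s)) ℝ)
    (p : ∀ s, Fin (N s) → ℝ) (hp : ∀ s, IsProbVec (p s))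
    (q : Fin M → ℝ) (hq : IsProbVec q) (hqpos : ∀ j, 0 < q j)
    (Y : Matrix (Fin M) (Fin M) ℝ)
    (πs : ∀ s, Matrix (Fin (N s)) (Fin M) ℝ)
    (hopt : ∀ s, IsOptimalCoupling (X s) (p s) Y q (πs s))
    (F : Fin S → Matrix (Fin M) (Fin M) ℝ)
    (hF : ∀ s j l, F s j l = (1 / (q j * q l)) * ((πs s)ᵀ * X s * πs s) j l)
    (Q : Matrix (Fin S) (Fin S) ℝ)
    (hQ : ∀ s r, Q s r = Matrix.trace ((F s - Y)ᵀ * (F r - Y))) :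
    Q.PosSemidef ∧
    (∀ lam : Fin S → ℝ, IsProbVec lam →
      (∑ s, ∑ r, lam s * Q s r * lam r = 0 ↔ Y = ∑ s, lam s • F s)) ∧
    (∀ lamY : Fin S → ℝ, IsProbVec lamY →
      (∀ Z : Matrix (Fin M) (Fin M) ℝ,
        ∑ s, lamY s * GW2 (X s) (p s) Y q ≤ ∑ s, lamY s * GW2 (X s) (p s) Z q) →
      (∑ s, ∑ r, lamY s * Q s r * lamY r = 0 ∧
        ∀ lam : Fin S → ℝ, IsProbVec lam →
          ∑ s, ∑ r, lamY s * Q s r * lamY r ≤ ∑ s, ∑ r, lam s * Q s r * lam r)) := by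
  have hquad : ∀ a : Fin S → ℝ, ∑ s, ∑ r, a s * Q s r * a r
      = ∑ j, ∑ l, (∑ s, a s * (F s - Y) j l) ^ 2 := by
    intro a
    rw [← aux_quad (fun s => F s - Y) a]
    simp only [hQ]
  have hnn : ∀ a : Fin S → ℝ, 0 ≤ ∑ s, ∑ r, a s * Q s r * a r := by
    intro a
    rw [hquad]
    exact Finset.sum_nonneg fun j _ => Finset.sum_nonneg fun l _ => sq_nonneg _
  have hD : ∀ lam : Fin S → ℝ, IsProbVec lam → ∀ j l,
      ∑ s, lam s * (F s - Y) j l = (∑ s, lam s * F s j l) - Y j l := by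
    intro lam hlam j l
    simp only [Matrix.sub_apply, mul_sub, Finset.sum_sub_distrib, ← Finset.sum_mul, hlam.2, one_mul]
  have hB : ∀ lam : Fin S → ℝ, ∀ j l, (∑ s, lam s • F s) j l = ∑ s, lam s * F s j l := by
    intro lam j l
    simp [Matrix.sum_apply]
  have hii : ∀ lam : Fin S → ℝ, IsProbVec lam →
      (∑ s, ∑ r, lam s * Q s r * lam r = 0 ↔ Y = ∑ s, lam s • F s) := by
    intro lam hlam
    rw [hquad]
    constructor
    · intro h
      ext j l
      rw [Finset.sum_eq_zero_iff_of_nonneg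
        (fun j _ => Finset.sum_nonneg fun l _ => sq_nonneg _)] at h
      have h' := h j (Finset.mem_univ _)
      rw [Finset.sum_eq_zero_iff_of_nonneg (fun l _ => sq_nonneg _)] at h'
      have h'' := pow_eq_zero_iff (two_ne_zero) |>.1 (h' l (Finset.mem_univ _))
      rw [hD lam hlam] at h''
      rw [hB]; linarith
    · intro h
      refine Finset.sum_eq_zero fun j _ => Finset.sum_eq_zero fun l _ => ?_
      rw [hD lam hlam, ← hB, ← h]; simp
  refine ⟨?_, hii, ?_⟩
  · have : Q = (Matrix.of fun (x : Fin M × Fin M) s => (F s - Y) x.1 x.2)ᴴ *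
        (Matrix.of fun (x : Fin M × Fin M) s => (F s - Y) x.1 x.2) := by
      ext s r
      rw [hQ, Matrix.mul_apply, Fintype.sum_prod_type, Finset.sum_comm]
      simp [Matrix.trace, Matrix.mul_apply]
    rw [this]
    exact Matrix.posSemidef_conjTranspose_mul_self _
  · intro lam hlam hbary
    have h0 : ∑ s, ∑ r, lam s * Q s r * lam r = 0 := by
      rw [hii lam hlam]
      set B := ∑ s, lam s • F s with hBdef
      have hobj := fun s Z => aux_obj (X s) Z q hqpos (πs s) (hopt s).1.2.2 (F s) (hF s)
      have h1 : ∑ s, lam s * GWobj (X s) Y (πs s) ≤ ∑ s, lam s * GWobj (X s) B (πs s) := by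
        calc _ = ∑ s, lam s * GW2 (X s) (p s) Y q :=
              Finset.sum_congr rfl fun s _ => by rw [(hopt s).2]
          _ ≤ _ := hbary B
          _ ≤ _ := Finset.sum_le_sum fun s _ => mul_le_mul_of_nonneg_left
              (aux_gw_le _ _ _ _ _ (hopt s).1) (hlam.1 s)
      have hlin : ∀ Z : Matrix (Fin M) (Fin M) ℝ,
          ∑ s, lam s * ∑ j, ∑ l, q j * q l * (Z j l ^ 2 - 2 * Z j l * F s j l)
          = ∑ j, ∑ l, q j * q l * (Z j l ^ 2 - 2 * Z j l * B j l) := by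
        intro Z
        simp only [Finset.mul_sum]
        rw [Finset.sum_comm]
        refine Finset.sum_congr rfl fun j _ => ?_
        rw [Finset.sum_comm]
        refine Finset.sum_congr rfl fun l _ => ?_
        have e : ∀ s, lam s * (q j * q l * (Z j l ^ 2 - 2 * Z j l * F s j l))
            = lam s * (q j * q l * Z j l ^ 2) - 2 * q j * q l * Z j l * (lam s * F s j l) := by
          intro s; ring
        simp only [e, Finset.sum_sub_distrib, ← Finset.sum_mul, ← Finset.mul_sum, hlam.2]
        rw [hBdef, hB]; ring
      simp only [hobj, mul_add, Finset.sum_add_distrib, hlin] at h1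
      have h2 := le_of_add_le_add_left h1
      have h3 : ∑ j, ∑ l, q j * q l * (Y j l - B j l) ^ 2 ≤ 0 := by
        have : ∑ j, ∑ l, q j * q l * (Y j l - B j l) ^ 2
            = ∑ j, ∑ l, q j * q l * (Y j l ^ 2 - 2 * Y j l * B j l)
              - ∑ j, ∑ l, q j * q l * (B j l ^ 2 - 2 * B j l * B j l) := by
          simp only [← Finset.sum_sub_distrib]
          refine Finset.sum_congr rfl fun j _ => Finset.sum_congr rfl fun l _ => ?_
          ring
        linarith
      have hn : ∀ j l, 0 ≤ q j * q l * (Y j l - B j l) ^ 2 := fun j l =>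
        mul_nonneg (mul_nonneg (hqpos j).le (hqpos l).le) (sq_nonneg _)
      have h4 := le_antisymm h3
        (Finset.sum_nonneg fun j _ => Finset.sum_nonneg fun l _ => hn j l)
      ext j l
      rw [Finset.sum_eq_zero_iff_of_nonneg
        (fun j _ => Finset.sum_nonneg fun l _ => hn j l)] at h4
      have h5 := h4 j (Finset.mem_univ _)
      rw [Finset.sum_eq_zero_iff_of_nonneg (fun l _ => hn j l)] at h5
      have h6 := h5 l (Finset.mem_univ _)
      have h7 := (mul_eq_zero.1 h6).resolve_left (mul_pos (hqpos j) (hqpos l)).ne'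
      have h8 := (pow_eq_zero_iff two_ne_zero).1 h7
      linarith
    refine ⟨h0, fun lam' _ => ?_⟩
    rw [h0]; exact hnn lam'
end
end

section
/- In the setting of the fixed-point analysis problem: let (X^s, p^s), s = 1,…,S, be finite networks, M ∈ ℕ, q ∈ 𝒫_M with all entries strictly positive, Y ∈ ℝ^{M×M}; for each s let π^s ∈ Π(p^s,q) be an optimal coupling for GW((X^s,p^s),(Y,q)), set F(Y,s) := (1/(qqᵀ)) ⊙ (π^s)ᵀ X^s π^s, Q_{sr} := tr((F(Y,s) − Y)ᵀ(F(Y,r) − Y)), K_{sr} := tr(F(Y,s)ᵀ F(Y,r)), and b_s := tr(Yᵀ F(Y,s)). Assume Y satisfies the barycentric coding model, i.e., there exists μ ∈ Δ_{S−1} with Y = Σ_{s=1}^S μ_s F(Y,s). Then for every λ ∈ Δ_{S−1}: λᵀQλ = 0 if and only if Kλ = b. -/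
open Finset Matrix

noncomputable section

/-- In the fixed-point analysis setting, with `F(Y,s)`, `Q`, `K`, `b` as in
Theorem 3.6 of the paper, if `Y` satisfies the barycentric coding model, i.e.
`Y = Σ_s μ_s F(Y,s)` for some `μ ∈ Δ_{S-1}`, then for every `λ ∈ Δ_{S-1}` we have
`λᵀQλ = 0` iff `Kλ = b`. -/
theorem quadratic_zero_iff_linear_system {S M : ℕ} (N : Fin S → ℕ)
    (X : ∀ s, Matrix (Fin (N s)) (Fin (N s)) ℝ)
    (p : ∀ s, Fin (N s) → ℝ) (hp : ∀ s, IsProbVec (p s))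
    (q : Fin M → ℝ) (hq : IsProbVec q) (hqpos : ∀ j, 0 < q j)
    (Y : Matrix (Fin M) (Fin M) ℝ)
    (πs : ∀ s, Matrix (Fin (N s)) (Fin M) ℝ)
    (hopt : ∀ s, IsOptimalCoupling (X s) (p s) Y q (πs s))
    (F : Fin S → Matrix (Fin M) (Fin M) ℝ)
    (hF : ∀ s j l, F s j l = (1 / (q j * q l)) * ((πs s)ᵀ * X s * πs s) j l)
    (Q K : Matrix (Fin S) (Fin S) ℝ) (b : Fin S → ℝ)
    (hQ : ∀ s r, Q s r = Matrix.trace ((F s - Y)ᵀ * (F r - Y)))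
    (hK : ∀ s r, K s r = Matrix.trace ((F s)ᵀ * F r))
    (hb : ∀ s, b s = Matrix.trace (Yᵀ * F s))
    (μ : Fin S → ℝ) (hμ : IsProbVec μ) (hbcm : Y = ∑ s, μ s • F s) :
    ∀ lam : Fin S → ℝ, IsProbVec lam →
      (∑ s, ∑ r, lam s * Q s r * lam r = 0 ↔ K.mulVec lam = b) := by
  intro lam hl
  set D : Matrix (Fin M) (Fin M) ℝ := ∑ s, lam s • (F s - Y) with hD
  have hD1 : D = ∑ s, lam s • F s - Y := by
    rw [hD]
    simp only [smul_sub, Finset.sum_sub_distrib]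
    rw [← Finset.sum_smul, hl.2, one_smul]
  have hD2 : D = ∑ s, (lam s - μ s) • F s := by
    rw [hD1]
    simp only [sub_smul, Finset.sum_sub_distrib]
    rw [← hbcm]
  have h1 : ∑ s, ∑ r, lam s * Q s r * lam r = Matrix.trace (Dᵀ * D) := by
    conv_rhs => rw [hD]
    rw [Matrix.transpose_sum, Matrix.sum_mul, Matrix.trace_sum]
    refine Finset.sum_congr rfl fun s _ => ?_
    rw [Matrix.mul_sum, Matrix.trace_sum]
    refine Finset.sum_congr rfl fun r _ => ?_
    rw [hQ, Matrix.transpose_smul, Matrix.smul_mul, Matrix.mul_smul, Matrix.trace_smul,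
      Matrix.trace_smul, smul_eq_mul, smul_eq_mul]
    ring
  have h2 : ∀ s, K.mulVec lam s - b s = Matrix.trace ((F s)ᵀ * D) := by
    intro s
    rw [hD1, Matrix.mul_sub, Matrix.trace_sub, Matrix.mul_sum, Matrix.trace_sum, hb,
      ← Matrix.trace_transpose (Yᵀ * F s), Matrix.transpose_mul, Matrix.transpose_transpose]
    congr 1
    simp only [Matrix.mulVec, dotProduct]
    refine Finset.sum_congr rfl fun r _ => ?_
    rw [hK, Matrix.mul_smul, Matrix.trace_smul, smul_eq_mul]
    ring
  rw [h1]
  constructor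
  · intro h
    have h0 : D = 0 := by
      rw [← Matrix.conjTranspose_eq_transpose_of_trivial] at h
      exact Matrix.trace_conjTranspose_mul_self_eq_zero_iff.mp h
    funext s
    have := h2 s
    rw [h0, Matrix.mul_zero, Matrix.trace_zero] at this
    linarith
  · intro h
    have h3 : ∀ s, Matrix.trace ((F s)ᵀ * D) = 0 := by
      intro s
      rw [← h2, h, sub_self]
    have h4 : Dᵀ = ∑ s, (lam s - μ s) • (F s)ᵀ := by
      conv_lhs => rw [hD2]
      rw [Matrix.transpose_sum]
      rfl
    rw [h4, Matrix.sum_mul, Matrix.trace_sum]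
    refine Finset.sum_eq_zero fun s _ => ?_
    rw [Matrix.smul_mul, Matrix.trace_smul, h3, smul_zero]
end
end

section
/- Let (X^s, p^s) ∈ ℝ^{N^s×N^s} × 𝒫_{N^s} for s = 1,…,S be finite networks in which every matrix X^s has nonnegative entries, let λ ∈ Δ_{S−1}, let M ∈ ℕ, and let q ∈ 𝒫_M. Then the minimization problem min over Y ∈ ℝ^{M×M} with nonnegative entries of Σ_{s=1}^S λ_s GW²((X^s,p^s),(Y,q)) attains its infimum; that is, there exists a matrix Y_λ with nonnegative entries such that Σ_{s=1}^S λ_s GW²((X^s,p^s),(Y_λ,q)) ≤ Σ_{s=1}^S λ_s GW²((X^s,p^s),(Y,q)) for every Y ∈ ℝ^{M×M} with nonnegative entries. -/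
open Finset Matrix

noncomputable section

theorem couplings_compact {N M : ℕ} (p : Fin N → ℝ) (q : Fin M → ℝ) :
    IsCompact (Couplings p q) := by
  have hbox : IsCompact (Set.pi Set.univ (fun i : Fin N =>
      Set.pi Set.univ (fun _ : Fin M => Set.Icc (0 : ℝ) (p i)))) :=
    isCompact_univ_pi fun i => isCompact_univ_pi fun j => isCompact_Icc
  refine IsCompact.of_isClosed_subset (X := Fin N → Fin M → ℝ) hbox ?_ ?_
  · have h1 : IsClosed {π : Fin N → Fin M → ℝ | ∀ i j, 0 ≤ π i j} := by
      simp only [Set.ofPred_forall]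
      exact isClosed_iInter fun i => isClosed_iInter fun j =>
        isClosed_le continuous_const (by fun_prop)
    have h2 : IsClosed {π : Fin N → Fin M → ℝ | ∀ i, ∑ j, π i j = p i} := by
      simp only [Set.ofPred_forall]
      exact isClosed_iInter fun i => isClosed_eq (by fun_prop) continuous_const
    have h3 : IsClosed {π : Fin N → Fin M → ℝ | ∀ j, ∑ i, π i j = q j} := by
      simp only [Set.ofPred_forall]
      exact isClosed_iInter fun i => isClosed_eq (by fun_prop) continuous_const
    exact h1.inter (h2.inter h3)
  · rintro π ⟨h0, h1, -⟩ i - j -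
    refine ⟨h0 i j, ?_⟩
    rw [← h1 i]
    exact Finset.single_le_sum (f := fun j => π i j) (fun j _ => h0 i j) (Finset.mem_univ j)

theorem couplings_nonempty {N M : ℕ} {p : Fin N → ℝ} {q : Fin M → ℝ}
    (hp : IsProbVec p) (hq : IsProbVec q) : (Couplings p q).Nonempty := by
  refine ⟨fun i j => p i * q j, fun i j => mul_nonneg (hp.1 i) (hq.1 j), fun i => ?_, fun j => ?_⟩
  · rw [← Finset.mul_sum, hq.2, mul_one]
  · rw [← Finset.sum_mul, hp.2, one_mul]

theorem gwobj_continuous {T : Type} [TopologicalSpace T] {N M : ℕ}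
    (X : Matrix (Fin N) (Fin N) ℝ) (f : T → Fin M → Fin M → ℝ) (g : T → Fin N → Fin M → ℝ)
    (hf : Continuous f) (hg : Continuous g) :
    Continuous (fun z : T => GWobj X (f z) (g z)) := by
  unfold GWobj
  fun_prop

theorem clip_sq {x y B : ℝ} (hx : x ≤ B) : (x - min y B) ^ 2 ≤ (x - y) ^ 2 := by
  rcases le_total y B with h | h
  · rw [min_eq_left h]
  · rw [min_eq_right h]
    nlinarith

theorem gw2_le {N M : ℕ} (X : Matrix (Fin N) (Fin N) ℝ) (p : Fin N → ℝ)
    (Y : Matrix (Fin M) (Fin M) ℝ) (q : Fin M → ℝ) {π : Matrix (Fin N) (Fin M) ℝ}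
    (hπ : π ∈ Couplings p q) : GW2 X p Y q ≤ GWobj X Y π := by
  refine csInf_le ⟨0, ?_⟩ ⟨π, hπ, rfl⟩
  rintro _ ⟨ρ, hρ, rfl⟩
  exact Finset.sum_nonneg fun i _ => Finset.sum_nonneg fun k _ => Finset.sum_nonneg fun j _ =>
    Finset.sum_nonneg fun l _ => mul_nonneg (mul_nonneg (sq_nonneg _) (hρ.1 i j)) (hρ.1 k l)

theorem gw2_attained {N M : ℕ} (X : Matrix (Fin N) (Fin N) ℝ) {p : Fin N → ℝ}
    (Y : Matrix (Fin M) (Fin M) ℝ) {q : Fin M → ℝ} (hp : IsProbVec p) (hq : IsProbVec q) :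
    ∃ π ∈ Couplings p q, GWobj X Y π = GW2 X p Y q := by
  have hc : Continuous (fun π : Matrix (Fin N) (Fin M) ℝ => GWobj X Y π) :=
    gwobj_continuous X (fun _ => Y) (fun π => π) continuous_const continuous_id
  have h := ((couplings_compact p q).image hc).sInf_mem ((couplings_nonempty hp hq).image _)
  exact h

/-- If all template matrices `X^s` have nonnegative entries, then for any
`λ ∈ Δ_{S-1}`, `M ∈ ℕ` and `q ∈ 𝒫_M`, the functional
`Y ↦ Σ_s λ_s GW²((X^s,p^s),(Y,q))` attains its infimum over the set of `M×M` matrices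
with nonnegative entries. -/
theorem gw_synthesis_minimizer_exists {S M : ℕ} (N : Fin S → ℕ)
    (X : ∀ s, Matrix (Fin (N s)) (Fin (N s)) ℝ)
    (hXnn : ∀ s i k, 0 ≤ X s i k)
    (p : ∀ s, Fin (N s) → ℝ) (hp : ∀ s, IsProbVec (p s))
    (lam : Fin S → ℝ) (hlam : IsProbVec lam)
    (q : Fin M → ℝ) (hq : IsProbVec q) :
    ∃ Ylam : Matrix (Fin M) (Fin M) ℝ, (∀ j l, 0 ≤ Ylam j l) ∧
      ∀ Y : Matrix (Fin M) (Fin M) ℝ, (∀ j l, 0 ≤ Y j l) →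
        ∑ s, lam s * GW2 (X s) (p s) Ylam q ≤ ∑ s, lam s * GW2 (X s) (p s) Y q := by
  obtain ⟨B, hB0, hB⟩ : ∃ B : ℝ, 0 ≤ B ∧ ∀ s i k, X s i k ≤ B := by
    refine ⟨∑ s, ∑ i, ∑ k, X s i k, Finset.sum_nonneg fun s _ => Finset.sum_nonneg fun i _ =>
      Finset.sum_nonneg fun k _ => hXnn s i k, fun s i k => ?_⟩
    calc X s i k ≤ ∑ k, X s i k :=
          Finset.single_le_sum (f := fun k => X s i k) (fun k _ => hXnn s i k) (Finset.mem_univ k)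
      _ ≤ ∑ i, ∑ k, X s i k :=
          Finset.single_le_sum (f := fun i => ∑ k, X s i k)
            (fun i _ => Finset.sum_nonneg fun k _ => hXnn s i k) (Finset.mem_univ i)
      _ ≤ _ :=
          Finset.single_le_sum (f := fun s => ∑ i, ∑ k, X s i k)
            (fun s _ => Finset.sum_nonneg fun i _ => Finset.sum_nonneg fun k _ => hXnn s i k)
            (Finset.mem_univ s)
  let KY : Set (Fin M → Fin M → ℝ) :=
    Set.pi Set.univ fun _ => Set.pi Set.univ fun _ => Set.Icc (0 : ℝ) B
  have hKY : IsCompact KY := isCompact_univ_pi fun i => isCompact_univ_pi fun j => isCompact_Icc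
  let KP : Set (∀ s, Fin (N s) → Fin M → ℝ) := Set.pi Set.univ fun s => Couplings (p s) q
  have hKP : IsCompact KP := isCompact_univ_pi fun s => couplings_compact (p s) q
  have hne : (KY ×ˢ KP).Nonempty := by
    refine Set.Nonempty.prod ⟨fun _ _ => 0, fun _ _ _ _ => ⟨le_rfl, hB0⟩⟩ ?_
    exact Set.univ_pi_nonempty_iff.2 fun s => couplings_nonempty (hp s) hq
  have hcont : Continuous (fun z : (Fin M → Fin M → ℝ) × (∀ s, Fin (N s) → Fin M → ℝ) =>
      ∑ s, lam s * GWobj (X s) z.1 (z.2 s)) := by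
    have h1 : ∀ s, Continuous (fun z : (Fin M → Fin M → ℝ) × (∀ s, Fin (N s) → Fin M → ℝ) =>
        GWobj (X s) z.1 (z.2 s)) := by
      intro s
      have hz1 : Continuous (fun z : (Fin M → Fin M → ℝ) × (∀ s, Fin (N s) → Fin M → ℝ) => z.1) :=
        continuous_fst
      have hz2 : Continuous
          (fun z : (Fin M → Fin M → ℝ) × (∀ s, Fin (N s) → Fin M → ℝ) => z.2 s) :=
        (continuous_apply s).comp continuous_snd
      exact gwobj_continuous (X s) _ _ hz1 hz2
    exact continuous_finsetSum _ fun s _ => continuous_const.mul (h1 s)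
  obtain ⟨⟨Y0, P0⟩, ⟨hY0, hP0⟩, hmin⟩ := (hKY.prod hKP).exists_isMinOn hne hcont.continuousOn
  replace hmin := isMinOn_iff.1 hmin
  dsimp only at hmin hY0 hP0
  refine ⟨Y0, fun j l => (hY0 j trivial l trivial).1, fun Y hY => ?_⟩
  choose P hP hPe using fun s => gw2_attained (X s) Y (hp s) hq
  have hm : ∑ s, lam s * GWobj (X s) Y0 (P0 s) ≤
      ∑ s, lam s * GWobj (X s) (fun j l => min (Y j l) B) (P s) :=
    hmin ((fun j l => min (Y j l) B), P)
      ⟨fun j _ l _ => ⟨le_min (hY j l) hB0, min_le_right _ _⟩, fun s _ => hP s⟩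
  calc _ ≤ ∑ s, lam s * GWobj (X s) Y0 (P0 s) :=
        Finset.sum_le_sum fun s _ => mul_le_mul_of_nonneg_left
          (gw2_le _ _ _ _ (hP0 s trivial)) (hlam.1 s)
    _ ≤ _ := hm
    _ ≤ _ := by
        refine Finset.sum_le_sum fun s _ => mul_le_mul_of_nonneg_left ?_ (hlam.1 s)
        rw [← hPe s]
        refine Finset.sum_le_sum fun i _ => Finset.sum_le_sum fun k _ =>
          Finset.sum_le_sum fun j _ => Finset.sum_le_sum fun l _ => ?_
        refine mul_le_mul_of_nonneg_right (mul_le_mul_of_nonneg_right ?_ ((hP s).1 i j))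
          ((hP s).1 k l)
        exact clip_sq (hB s i k)
end
end

section
/- Let X and Y be finite metric spaces with metrics d_X and d_Y, and let μ_X and μ_Y be probability measures on X and Y with full support (i.e., μ_X({x}) > 0 for every x ∈ X and μ_Y({y}) > 0 for every y ∈ Y). Suppose there exist a finite probability space (Z, μ_Z) and maps φ_X : Z → X and φ_Y : Z → Y such that the pushforward of μ_Z by φ_X equals μ_X, the pushforward of μ_Z by φ_Y equals μ_Y, and d_X(φ_X(z), φ_X(z')) = d_Y(φ_Y(z), φ_Y(z')) for all z, z' ∈ Z. Then there exists a bijection φ : X → Y that is an isometry (d_Y(φ(x), φ(x')) = d_X(x, x') for all x, x' ∈ X) and pushes μ_X forward to μ_Y (i.e., μ_Y({y}) = μ_X({x : φ(x) = y}) for all y ∈ Y). In other words, weakly isomorphic finite metric measure spaces are strongly isomorphic. -/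
open Finset

noncomputable section

/-- Weakly isomorphic finite metric measure spaces are strongly isomorphic.
If finite metric spaces `X`, `Y` carry fully supported probability measures `μX`, `μY`
and there is a finite probability space `(Z, μZ)` with maps `φX : Z → X`, `φY : Z → Y`
pushing `μZ` forward to `μX` and `μY` and with `d_X(φX z, φX z') = d_Y(φY z, φY z')`
for all `z, z'`, then there is a measure-preserving bijective isometry `φ : X → Y`. -/
theorem weak_iso_implies_strong_iso
    {X Y Z : Type*} [Fintype X] [Fintype Y] [Fintype Z]
    [DecidableEq X] [DecidableEq Y]
    [MetricSpace X] [MetricSpace Y]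
    (μX : X → ℝ) (μY : Y → ℝ) (μZ : Z → ℝ)
    (hμXpos : ∀ x, 0 < μX x) (hμYpos : ∀ y, 0 < μY y)
    (hμXsum : ∑ x, μX x = 1) (hμYsum : ∑ y, μY y = 1)
    (hμZnn : ∀ z, 0 ≤ μZ z) (hμZsum : ∑ z, μZ z = 1)
    (φX : Z → X) (φY : Z → Y)
    (hpushX : ∀ x, ∑ z ∈ Finset.univ.filter (fun z => φX z = x), μZ z = μX x)
    (hpushY : ∀ y, ∑ z ∈ Finset.univ.filter (fun z => φY z = y), μZ z = μY y)
    (hiso : ∀ z z', dist (φX z) (φX z') = dist (φY z) (φY z')) :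
    ∃ φ : X → Y, Function.Bijective φ ∧
      (∀ x x', dist (φ x) (φ x') = dist x x') ∧
      (∀ y, μY y = ∑ x ∈ Finset.univ.filter (fun x => φ x = y), μX x) := by
  have sX : ∀ x, ∃ z, φX z = x := by
    intro x
    by_contra! h
    have h1 := hpushX x
    rw [Finset.filter_false_of_mem (fun z _ => h z), Finset.sum_empty] at h1
    exact (hμXpos x).ne h1
  have sY : ∀ y, ∃ z, φY z = y := by
    intro y
    by_contra! h
    have h1 := hpushY y
    rw [Finset.filter_false_of_mem (fun z _ => h z), Finset.sum_empty] at h1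
    exact (hμYpos y).ne h1
  have key : ∀ z z', φX z = φX z' ↔ φY z = φY z' := by
    intro z z'
    rw [← dist_eq_zero, hiso, dist_eq_zero]
  choose s hs using sX
  have inj : ∀ x x', φY (s x) = φY (s x') ↔ x = x' := by
    intro x x'
    rw [← key, hs, hs]
  have surj : ∀ y, ∃ x, φY (s x) = y := by
    intro y
    obtain ⟨z, rfl⟩ := sY y
    exact ⟨φX z, (key _ _).1 (hs _)⟩
  refine ⟨fun x => φY (s x), ⟨fun x x' h => (inj x x').1 h, surj⟩, ?_, ?_⟩
  · intro x x'
    rw [← hiso, hs, hs]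
  · intro y
    obtain ⟨x, rfl⟩ := surj y
    have h1 : Finset.univ.filter (fun x' => φY (s x') = φY (s x)) = {x} := by
      ext x'
      simp [inj]
    rw [h1, Finset.sum_singleton, ← hpushY, ← hpushX]
    congr 1
    ext z
    simp only [Finset.mem_filter, Finset.mem_univ, true_and]
    rw [← key, hs]
end
end

section
/- Let X^1_b,…,X^S_b, Y* ∈ ℝ^{M_b×M_b} be matrices and let q_b ∈ 𝒫_{M_b} have all entries strictly positive. Suppose that for each s ∈ [S] the diagonal coupling diag(q_b) ∈ Π(q_b,q_b) is optimal for GW((X^s_b,q_b),(Y*,q_b)), i.e., GW²((X^s_b,q_b),(Y*,q_b)) = Σ_{j,k∈[M_b]} (X^s_b[j,k] − Y*[j,k])² q_b[j] q_b[k]. Let λ ∈ Δ_{S−1} and suppose (Y*,q_b) is a Gromov–Wasserstein barycenter for weights λ, in the sense that Σ_{s=1}^S λ_s GW²((X^s_b,q_b),(Y*,q_b)) ≤ Σ_{s=1}^S λ_s GW²((X^s_b,q_b),(Z,r)) for every M ∈ ℕ and every finite network (Z,r) ∈ ℝ^{M×M} × 𝒫_M. Then Y* = Σ_{s=1}^S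 λ_s X^s_b. -/
open Finset Matrix

noncomputable section

lemma GWobj_diag_aux {N : ℕ} (X Y : Matrix (Fin N) (Fin N) ℝ) (q : Fin N → ℝ) :
    GWobj X Y (Matrix.diagonal q) = ∑ j, ∑ k, (X j k - Y j k) ^ 2 * q j * q k := by
  unfold GWobj
  refine Finset.sum_congr rfl fun i _ => Finset.sum_congr rfl fun k _ => ?_
  rw [Finset.sum_eq_single i, Finset.sum_eq_single k]
  · simp
  · intro b _ hb
    simp [Matrix.diagonal_apply_ne' _ hb]
  · simp
  · intro b _ hb
    simp [Matrix.diagonal_apply_ne' _ hb]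
  · simp

lemma GW2_le_aux {N : ℕ} (X Y : Matrix (Fin N) (Fin N) ℝ) (q : Fin N → ℝ)
    (hq : Matrix.diagonal q ∈ Couplings q q) :
    GW2 X q Y q ≤ ∑ j, ∑ k, (X j k - Y j k) ^ 2 * q j * q k := by
  rw [← GWobj_diag_aux]
  refine csInf_le ⟨0, ?_⟩ ⟨_, hq, rfl⟩
  rintro _ ⟨π, hπ, rfl⟩
  unfold GWobj
  refine Finset.sum_nonneg fun i _ => Finset.sum_nonneg fun k _ =>
    Finset.sum_nonneg fun j _ => Finset.sum_nonneg fun l _ => ?_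
  exact mul_nonneg (mul_nonneg (sq_nonneg _) (hπ.1 _ _)) (hπ.1 _ _)

lemma var_aux {S : ℕ} (lam x : Fin S → ℝ) (h : ∑ s, lam s = 1) (y : ℝ) :
    ∑ s, lam s * (x s - y) ^ 2
      = ∑ s, lam s * (x s - ∑ t, lam t * x t) ^ 2 + (y - ∑ t, lam t * x t) ^ 2 := by
  have key : ∀ c : ℝ, ∑ s, lam s * (x s - c) ^ 2
      = ∑ s, lam s * x s ^ 2 - 2 * c * ∑ s, lam s * x s + c ^ 2 := by
    intro c
    calc _ = ∑ s, (lam s * x s ^ 2 - 2 * c * (lam s * x s) + c ^ 2 * lam s) :=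
          Finset.sum_congr rfl fun s _ => by ring
      _ = _ := by
          rw [Finset.sum_add_distrib, Finset.sum_sub_distrib, ← Finset.mul_sum,
            ← Finset.mul_sum, h, mul_one]
  rw [key, key]
  ring

/-- After an optimal blow-up (all matrices of common size `M_b`, common node
weights `q_b` with strictly positive entries, and the diagonal coupling optimal for each
`GW((X^s_b,q_b),(Y*,q_b))`), if `(Y*,q_b)` is a GW barycenter for weights `λ ∈ Δ_{S-1}`,
i.e. it minimizes `Σ_s λ_s GW²((X^s_b,q_b),(Z,r))` over all finite networks `(Z,r)` of any
size `M`, then `Y* = Σ_s λ_s X^s_b`. -/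
theorem blowup_barycenter_is_convex_combination {S Mb : ℕ}
    (Xb : Fin S → Matrix (Fin Mb) (Fin Mb) ℝ) (Ystar : Matrix (Fin Mb) (Fin Mb) ℝ)
    (qb : Fin Mb → ℝ) (hqb : IsProbVec qb) (hqbpos : ∀ i, 0 < qb i)
    (hdiag : ∀ s, IsOptimalCoupling (Xb s) qb Ystar qb (Matrix.diagonal qb))
    (hval : ∀ s, GW2 (Xb s) qb Ystar qb
      = ∑ j, ∑ k, (Xb s j k - Ystar j k) ^ 2 * qb j * qb k)
    (lam : Fin S → ℝ) (hlam : IsProbVec lam)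
    (hbary : ∀ (M : ℕ) (Z : Matrix (Fin M) (Fin M) ℝ) (r : Fin M → ℝ), IsProbVec r →
      ∑ s, lam s * GW2 (Xb s) qb Ystar qb ≤ ∑ s, lam s * GW2 (Xb s) qb Z r) :
    Ystar = ∑ s, lam s • Xb s := by
  rcases Nat.eq_zero_or_pos S with hS | hS
  · subst hS
    simpa using hlam.2
  have hc : Matrix.diagonal qb ∈ Couplings qb qb := (hdiag ⟨0, hS⟩).1
  set Z : Matrix (Fin Mb) (Fin Mb) ℝ := ∑ s, lam s • Xb s with hZ
  have hZe : ∀ j k, Z j k = ∑ s, lam s * Xb s j k := by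
    intro j k
    simp [hZ, Matrix.sum_apply]
  have swap : ∀ W : Matrix (Fin Mb) (Fin Mb) ℝ,
      ∑ s, lam s * ∑ j, ∑ k, (Xb s j k - W j k) ^ 2 * qb j * qb k
        = ∑ j, ∑ k, (∑ s, lam s * (Xb s j k - W j k) ^ 2) * (qb j * qb k) := by
    intro W
    simp only [Finset.mul_sum, Finset.sum_mul]
    rw [Finset.sum_comm]
    refine Finset.sum_congr rfl fun j _ => ?_
    rw [Finset.sum_comm]
    refine Finset.sum_congr rfl fun k _ => Finset.sum_congr rfl fun s _ => ?_
    ring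
  have h1 : ∑ s, lam s * GW2 (Xb s) qb Ystar qb
      = ∑ j, ∑ k, (∑ s, lam s * (Xb s j k - Ystar j k) ^ 2) * (qb j * qb k) := by
    rw [← swap]
    exact Finset.sum_congr rfl fun s _ => by rw [hval]
  have h2 : ∑ s, lam s * GW2 (Xb s) qb Z qb
      ≤ ∑ j, ∑ k, (∑ s, lam s * (Xb s j k - Z j k) ^ 2) * (qb j * qb k) := by
    rw [← swap]
    exact Finset.sum_le_sum fun s _ =>
      mul_le_mul_of_nonneg_left (GW2_le_aux _ _ _ hc) (hlam.1 s)
  have h3 : ∑ j, ∑ k, (∑ s, lam s * (Xb s j k - Ystar j k) ^ 2) * (qb j * qb k)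
      = ∑ j, ∑ k, (∑ s, lam s * (Xb s j k - Z j k) ^ 2) * (qb j * qb k)
        + ∑ j, ∑ k, (Ystar j k - Z j k) ^ 2 * (qb j * qb k) := by
    rw [← Finset.sum_add_distrib]
    refine Finset.sum_congr rfl fun j _ => ?_
    rw [← Finset.sum_add_distrib]
    refine Finset.sum_congr rfl fun k _ => ?_
    rw [var_aux lam (fun s => Xb s j k) hlam.2, ← hZe]
    ring
  have h4 := hbary Mb Z qb hqb
  have h5 : ∑ j, ∑ k, (Ystar j k - Z j k) ^ 2 * (qb j * qb k) ≤ 0 := by linarith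
  have nn : ∀ j k, 0 ≤ (Ystar j k - Z j k) ^ 2 * (qb j * qb k) := fun j k =>
    mul_nonneg (sq_nonneg _) (mul_pos (hqbpos j) (hqbpos k)).le
  have nn2 : ∀ j, 0 ≤ ∑ k, (Ystar j k - Z j k) ^ 2 * (qb j * qb k) := fun j =>
    Finset.sum_nonneg fun k _ => nn j k
  have h6 := le_antisymm h5 (Finset.sum_nonneg fun j _ => nn2 j)
  ext j k
  have h7 := (Finset.sum_eq_zero_iff_of_nonneg fun j _ => nn2 j).1 h6 j (Finset.mem_univ _)
  have h8 := (Finset.sum_eq_zero_iff_of_nonneg fun k _ => nn j k).1 h7 k (Finset.mem_univ _)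
  have h9 := (mul_eq_zero.1 h8).resolve_right (mul_pos (hqbpos j) (hqbpos k)).ne'
  exact sub_eq_zero.1 (pow_eq_zero_iff (two_ne_zero) |>.1 h9)
end
end
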